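/- Let h(k) be the number of pairs (a,b) of nonnegative integers with 4a+6b=k (so h(k)=0 for k<0), and set χ(k) = h(k) − h(−10−k) for k ∈ ℤ. Then in the formal power series ring ℤ[[q,q₁]], the series F = ∑_{d,d₁≥0} χ(d₁−d) q^d q₁^{d₁} satisfies F·(1−q^4)(1−q^6)(1−q₁^4)(1−q₁^6) = (1+qq₁)·(1 − q^4 − q^6 − q^6q₁^2 − q^8q₁^2 − q^8q₁^4 + q^2q₁^2 + q^4q₁^4 + q^6q₁^6 + q^8q₁^8). -/

import Mathlib

/-- `hInt k` is the number of pairs `(a, b)` of nonnegative integers with `4a + 6b = k`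
(so `hInt k = 0` for `k < 0`). -/
noncomputable def hInt (k : ℤ) : ℤ :=
  (Nat.card {p : ℕ × ℕ // 4 * (p.1 : ℤ) + 6 * (p.2 : ℤ) = k} : ℤ)

/-- `chiInt k = h(k) - h(-10 - k)`. -/
noncomputable def chiInt (k : ℤ) : ℤ := hInt k - hInt (-10 - k)

/-- The generating function `F = ∑_{d, d₁ ≥ 0} χ(d₁ - d) q^d q₁^{d₁}` in `ℤ[[q, q₁]]`,
where the variable `q` has index `0` and `q₁` has index `1`. -/
noncomputable def Fgen : MvPowerSeries (Fin 2) ℤ :=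
  fun d => chiInt ((d 1 : ℤ) - (d 0 : ℤ))

theorem hInt_neg {k : ℤ} (hk : k < 0) : hInt k = 0 := by
  unfold hInt
  have : IsEmpty {p : ℕ × ℕ // 4 * (p.1 : ℤ) + 6 * (p.2 : ℤ) = k} := ⟨fun ⟨p, hp⟩ => by omega⟩
  simp

theorem finite_pairs (k : ℤ) : Finite {p : ℕ × ℕ // 4 * (p.1 : ℤ) + 6 * (p.2 : ℤ) = k} := by
  refine Set.Finite.to_subtype (s := {p : ℕ × ℕ | 4 * (p.1 : ℤ) + 6 * (p.2 : ℤ) = k}) ?_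
  refine (Set.finite_Iic ((k.toNat, k.toNat) : ℕ × ℕ)).subset ?_
  rintro ⟨a, b⟩ h
  simp only [Set.mem_ofPred_eq] at h
  simp only [Set.mem_Iic, Prod.mk_le_mk]
  omega

noncomputable def gInt (k : ℤ) : ℤ := if 0 ≤ k ∧ k % 6 = 0 then 1 else 0

theorem card_six (k : ℤ) : (Nat.card {b : ℕ // 6 * (b : ℤ) = k} : ℤ) = gInt k := by
  unfold gInt
  have hs : Subsingleton {b : ℕ // 6 * (b : ℤ) = k} :=
    ⟨fun ⟨a, ha⟩ ⟨b, hb⟩ => Subtype.ext (by show a = b; omega)⟩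
  split_ifs with h
  · have : Nonempty {b : ℕ // 6 * (b : ℤ) = k} := ⟨⟨(k / 6).toNat, by omega⟩⟩
    rw [Nat.card_eq_one_iff_unique.2 ⟨hs, this⟩]; rfl
  · have : IsEmpty {b : ℕ // 6 * (b : ℤ) = k} := ⟨fun ⟨p, hp⟩ => by omega⟩
    simp

def pairEquiv (k : ℤ) : {p : ℕ × ℕ // 4 * (p.1 : ℤ) + 6 * (p.2 : ℤ) = k} ≃
    {p : ℕ × ℕ // 4 * (p.1 : ℤ) + 6 * (p.2 : ℤ) = k - 4} ⊕ {b : ℕ // 6 * (b : ℤ) = k} where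
  toFun
    | ⟨(0, b), h⟩ => Sum.inr ⟨b, by simpa using h⟩
    | ⟨(a + 1, b), h⟩ => Sum.inl ⟨(a, b), by push_cast at h ⊢; omega⟩
  invFun
    | Sum.inr ⟨b, h⟩ => ⟨(0, b), by simpa using h⟩
    | Sum.inl ⟨(a, b), h⟩ => ⟨(a + 1, b), by push_cast at h ⊢; omega⟩
  left_inv := by rintro ⟨⟨_ | a, b⟩, h⟩ <;> rfl
  right_inv := by rintro (⟨⟨a, b⟩, h⟩ | ⟨b, h⟩) <;> rfl

theorem hInt_step (k : ℤ) : hInt k = hInt (k - 4) + gInt k := by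
  have := finite_pairs (k - 4)
  have : Finite {b : ℕ // 6 * (b : ℤ) = k} :=
    @Finite.of_subsingleton _ ⟨fun ⟨a, ha⟩ ⟨b, hb⟩ => Subtype.ext (by show a = b; omega)⟩
  rw [← card_six]
  unfold hInt
  rw [Nat.card_congr (pairEquiv k), Nat.card_sum]
  push_cast
  rfl

theorem gInt_step (k : ℤ) : gInt k - gInt (k - 6) = if k = 0 then 1 else 0 := by
  unfold gInt
  split_ifs <;> omega

theorem hInt_rec (k : ℤ) :
    hInt k - hInt (k - 4) - hInt (k - 6) + hInt (k - 10) = if k = 0 then 1 else 0 := by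
  have h1 := hInt_step k
  have h2 := hInt_step (k - 6)
  rw [show k - 6 - 4 = k - 10 by ring] at h2
  linarith [gInt_step k]

/-- `∑ h(n) X_i^n`, where `j` is the other index. -/
noncomputable def Aser (i j : Fin 2) : MvPowerSeries (Fin 2) ℤ :=
  fun d => if d j = 0 then hInt (d i) else 0

theorem coeff_Aser (i j : Fin 2) (d : Fin 2 →₀ ℕ) :
    MvPowerSeries.coeff d (Aser i j) = if d j = 0 then hInt (d i) else 0 := rfl

theorem coeff_Fgen (d : Fin 2 →₀ ℕ) :
    MvPowerSeries.coeff d Fgen = chiInt ((d 1 : ℤ) - (d 0 : ℤ)) := rfl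

theorem coeff_Aser_mul (i j : Fin 2) (hij : i ≠ j) (n : ℕ) (d : Fin 2 →₀ ℕ) :
    MvPowerSeries.coeff d (Aser i j * MvPowerSeries.X i ^ n) =
      if d j = 0 then hInt ((d i : ℤ) - n) else 0 := by
  rw [MvPowerSeries.X_pow_eq, MvPowerSeries.coeff_mul_monomial, mul_one,
    if_congr Finsupp.single_le_iff rfl rfl,
    coeff_Aser]
  simp only [Finsupp.tsub_apply, Finsupp.single_eq_same, Finsupp.single_eq_of_ne hij.symm,
    Nat.sub_zero]
  by_cases hj : d j = 0
  · simp only [hj, if_true]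
    split_ifs with h
    · push_cast [h]; rfl
    · rw [hInt_neg]; omega
  · simp [hj]

theorem fin_eq_zero (i j : Fin 2) (hij : i ≠ j) (d : Fin 2 →₀ ℕ) :
    d = 0 ↔ d j = 0 ∧ d i = 0 := by
  constructor
  · rintro rfl; simp
  · rintro ⟨h1, h2⟩
    ext l
    have : l = i ∨ l = j := by omega
    rcases this with rfl | rfl <;> simpa

theorem Aser_mul (i j : Fin 2) (hij : i ≠ j) :
    Aser i j * ((1 - MvPowerSeries.X i ^ 4) * (1 - MvPowerSeries.X i ^ 6)) = 1 := by
  have : Aser i j * ((1 - MvPowerSeries.X i ^ 4) * (1 - MvPowerSeries.X i ^ 6)) =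
      Aser i j - Aser i j * MvPowerSeries.X i ^ 4 - Aser i j * MvPowerSeries.X i ^ 6 +
        Aser i j * MvPowerSeries.X i ^ 10 := by ring
  rw [this]
  ext d
  simp only [map_add, map_sub, coeff_Aser_mul i j hij, coeff_Aser]
  rw [MvPowerSeries.coeff_one, if_congr (fin_eq_zero i j hij d) rfl rfl]
  have := hInt_rec (d i)
  by_cases hj : d j = 0
  · simpa [hj] using this
  · simp [hj]

theorem Fgen_mul :
    Fgen * (1 - MvPowerSeries.X 0 * MvPowerSeries.X 1) =
      Aser 1 0 - Aser 0 1 * MvPowerSeries.X 0 ^ 10 := by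
  ext d
  rw [mul_sub, mul_one]
  have hX : (MvPowerSeries.X 0 * MvPowerSeries.X 1 : MvPowerSeries (Fin 2) ℤ) =
      MvPowerSeries.monomial (Finsupp.single 0 1 + Finsupp.single 1 1) 1 := by
    rw [MvPowerSeries.X, MvPowerSeries.X, MvPowerSeries.monomial_mul_monomial, mul_one]
  have hle : (Finsupp.single 0 1 + Finsupp.single 1 1 : Fin 2 →₀ ℕ) ≤ d ↔ 1 ≤ d 0 ∧ 1 ≤ d 1 := by
    rw [Finsupp.le_def, Fin.forall_fin_two]
    simp
  rw [map_sub, map_sub, coeff_Aser_mul 0 1 (by decide), hX, MvPowerSeries.coeff_mul_monomial,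
    if_congr hle rfl rfl, coeff_Aser, coeff_Fgen, coeff_Fgen]
  simp only [Finsupp.tsub_apply, Finsupp.add_apply, mul_one]
  have e0 : (Finsupp.single 0 1 : Fin 2 →₀ ℕ) 1 = 0 := by simp
  have e1 : (Finsupp.single 1 1 : Fin 2 →₀ ℕ) 0 = 0 := by simp
  rw [e0, e1, Finsupp.single_eq_same, Finsupp.single_eq_same]
  generalize d 0 = a
  generalize d 1 = b
  unfold chiInt
  rcases a with _ | a <;> rcases b with _ | b
  · simp
  · simp only [Nat.cast_zero, sub_zero]
    rw [hInt_neg (k := -10 - ((b + 1 : ℕ) : ℤ)) (by omega)]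
    simp
  · have : hInt (((0 : ℕ) : ℤ) - ((a + 1 : ℕ) : ℤ)) = 0 := hInt_neg (by omega)
    rw [this]
    simp
    congr 1; ring
  · simp

/-- `F · (1-q⁴)(1-q⁶)(1-q₁⁴)(1-q₁⁶) = (1+qq₁)(1 - q⁴ - q⁶ - q⁶q₁² - q⁸q₁² - q⁸q₁⁴
+ q²q₁² + q⁴q₁⁴ + q⁶q₁⁶ + q⁸q₁⁸)` in `ℤ[[q, q₁]]`. -/
theorem generating_function_X1_closed_form :
    letI q : MvPowerSeries (Fin 2) ℤ := MvPowerSeries.X 0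
    letI q₁ : MvPowerSeries (Fin 2) ℤ := MvPowerSeries.X 1
    Fgen * (1 - q ^ 4) * (1 - q ^ 6) * (1 - q₁ ^ 4) * (1 - q₁ ^ 6) =
      (1 + q * q₁) *
        (1 - q ^ 4 - q ^ 6 - q ^ 6 * q₁ ^ 2 - q ^ 8 * q₁ ^ 2 - q ^ 8 * q₁ ^ 4 +
          q ^ 2 * q₁ ^ 2 + q ^ 4 * q₁ ^ 4 + q ^ 6 * q₁ ^ 6 + q ^ 8 * q₁ ^ 8) := by
  set q : MvPowerSeries (Fin 2) ℤ := MvPowerSeries.X 0 with hq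
  set q₁ : MvPowerSeries (Fin 2) ℤ := MvPowerSeries.X 1 with hq₁
  have h1 := Aser_mul 1 0 (by decide)
  have h0 := Aser_mul 0 1 (by decide)
  have hF := Fgen_mul
  change Aser 1 0 * ((1 - q₁ ^ 4) * (1 - q₁ ^ 6)) = 1 at h1
  change Aser 0 1 * ((1 - q ^ 4) * (1 - q ^ 6)) = 1 at h0
  change Fgen * (1 - q * q₁) = Aser 1 0 - Aser 0 1 * q ^ 10 at hF
  have hne : (1 - q * q₁) ≠ 0 := by
    intro h
    have := congrArg MvPowerSeries.constantCoeff h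
    simp [q, q₁] at this
  apply mul_left_cancel₀ hne
  linear_combination (1 - q ^ 4) * (1 - q ^ 6) * (1 - q₁ ^ 4) * (1 - q₁ ^ 6) * hF +
    (1 - q ^ 4) * (1 - q ^ 6) * h1 - q ^ 10 * (1 - q₁ ^ 4) * (1 - q₁ ^ 6) * h0
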